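/- (Uniqueness of Lipschitz-sharp harmonic functions) Let G=(V,w,m,d₀) be a salami with the combinatorial distance d₀, and let ℋ₀ = {f ∈ Lip(1) : Δf ≡ 0 and ∇₊f(x) = ∇₋f(x) = 1 for all x ∈ V}. If f, g ∈ ℋ₀, then either f - g is constant or f + g is constant. -/

import Mathlib

open Filter

namespace SalamiPaper

variable {V : Type*}

/-- Locally finite: every vertex has finitely many neighbors. -/
def LocallyFinite (w : V → V → ℝ) : Prop := ∀ x : V, {y | 0 < w x y}.Finite

/-- Connectedness of the weighted graph: any two vertices are joined by a path. -/
def GraphConnected (w : V → V → ℝ) : Prop :=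
  ∀ x y : V, Relation.ReflTransGen (fun a b => 0 < w a b) x y

/-- The weighted graph Laplacian `Δf(x) = (1/m(x)) ∑_y w(x,y)(f(y)-f(x))`. -/
noncomputable def lap (w : V → V → ℝ) (m : V → ℝ) (f : V → ℝ) (x : V) : ℝ :=
  (m x)⁻¹ * ∑ᶠ y, w x y * (f y - f x)

/-- The vertex degree `Deg(x) = (1/m(x)) ∑_y w(x,y)`. -/
noncomputable def deg (w : V → V → ℝ) (m : V → ℝ) (x : V) : ℝ :=
  (m x)⁻¹ * ∑ᶠ y, w x y

/-- The set of `d`-lengths of adjacency paths from `x` to `y`. -/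
def pathLens (w : V → V → ℝ) (d : V → V → ℝ) (x y : V) : Set ℝ :=
  {L | ∃ (n : ℕ) (p : ℕ → V), p 0 = x ∧ p n = y ∧
    (∀ i < n, 0 < w (p i) (p (i + 1))) ∧
    L = ∑ i ∈ Finset.range n, d (p i) (p (i + 1))}

/-- `d` is a path metric on the graph with edge weight `w`. -/
def IsPathMetric (w : V → V → ℝ) (d : V → V → ℝ) : Prop :=
  (∀ x, d x x = 0) ∧ (∀ x y, x ≠ y → 0 < d x y) ∧ (∀ x y, d x y = d y x) ∧
  (∀ x y z, d x z ≤ d x y + d y z) ∧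
  (∀ x y, d x y = sInf (pathLens w d x y))

/-- All balls are finite. -/
def FiniteBalls (d : V → V → ℝ) : Prop := ∀ (x : V) (R : ℝ), {y | d x y ≤ R}.Finite

/-- The combinatorial graph distance (as a real number). -/
noncomputable def combDist (w : V → V → ℝ) (x y : V) : ℝ :=
  sInf {L | ∃ (n : ℕ) (p : ℕ → V), p 0 = x ∧ p n = y ∧
    (∀ i < n, 0 < w (p i) (p (i + 1))) ∧ L = (n : ℝ)}

/-- `Lip(1)`: the 1-Lipschitz functions with respect to `d`. -/
def Lip1 (d : V → V → ℝ) (f : V → ℝ) : Prop := ∀ x y, f y - f x ≤ d x y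

/-- The Ollivier curvature
`κ(x,y) = (1/d(x,y)) inf{Δf(x) - Δf(y) : f ∈ Lip(1), f(y)-f(x) = d(x,y)}`. -/
noncomputable def kappa (w : V → V → ℝ) (m : V → ℝ) (d : V → V → ℝ) (x y : V) : ℝ :=
  (d x y)⁻¹ * sInf {c | ∃ f : V → ℝ, Lip1 d f ∧ f y - f x = d x y ∧
    c = lap w m f x - lap w m f y}

/-- `m(A) = ∞`: the total measure of `A` is infinite. -/
def InfVolume (m : V → ℝ) (A : Set V) : Prop :=
  ∀ c : ℝ, ∃ F : Finset V, ↑F ⊆ A ∧ c < ∑ x ∈ F, m x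

/-- A salami partition `(X,Y,K)`. -/
def SalamiPartition (w : V → V → ℝ) (m : V → ℝ) (X Y K : Set V) : Prop :=
  X ∪ Y ∪ K = Set.univ ∧ Disjoint X Y ∧ Disjoint X K ∧ Disjoint Y K ∧
  K.Finite ∧ (∀ x ∈ X, ∀ y ∈ Y, w x y = 0) ∧ InfVolume m X ∧ InfVolume m Y

/-- Reachability inside a subset `A` of the vertex set. -/
def reachIn (w : V → V → ℝ) (A : Set V) : V → V → Prop :=
  Relation.ReflTransGen (fun a b => a ∈ A ∧ b ∈ A ∧ 0 < w a b)

/-- The induced subgraph on `A` is connected. -/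
def ConnectedIn (w : V → V → ℝ) (A : Set V) : Prop :=
  ∀ x ∈ A, ∀ y ∈ A, reachIn w A x y

/-- A connected salami partition: `K` induces a connected subgraph. -/
def ConnectedSalamiPartition (w : V → V → ℝ) (m : V → ℝ) (X Y K : Set V) : Prop :=
  SalamiPartition w m X Y K ∧ ConnectedIn w K

/-- The basic standing assumptions on a weighted graph `G = (V,w,m,d)`:
countable vertex set, symmetric non-negative edge weight vanishing on the diagonal,
positive vertex measure, local finiteness, connectedness,
`d` a path metric with finite balls. -/
def IsGraphBase (w : V → V → ℝ) (m : V → ℝ) (d : V → V → ℝ) : Prop :=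
  Countable V ∧ (∀ x y, w x y = w y x) ∧ (∀ x y, 0 ≤ w x y) ∧ (∀ x, w x x = 0) ∧
  (∀ x, 0 < m x) ∧ LocallyFinite w ∧ GraphConnected w ∧
  IsPathMetric w d ∧ FiniteBalls d

/-- Non-negative Ollivier curvature on all edges. -/
def NonnegCurv (w : V → V → ℝ) (m : V → ℝ) (d : V → V → ℝ) : Prop :=
  ∀ x y, 0 < w x y → 0 ≤ kappa w m d x y

/-- A salami: a connected, locally finite weighted graph with a path metric with
finite balls, non-negative Ollivier curvature, admitting a salami partition. -/
def IsSalami (w : V → V → ℝ) (m : V → ℝ) (d : V → V → ℝ) : Prop :=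
  IsGraphBase w m d ∧ NonnegCurv w m d ∧ ∃ X Y K : Set V, SalamiPartition w m X Y K

/-- `G` has at least `n` ends: there is a finite set `K` such that `V ∖ K` has at
least `n` infinite connected components. -/
def atLeastEnds (w : V → V → ℝ) (n : ℕ) : Prop :=
  ∃ K : Set V, K.Finite ∧ ∃ x : Fin n → V,
    (∀ i, x i ∉ K) ∧ (∀ i, {y | reachIn w Kᶜ (x i) y}.Infinite) ∧
    (∀ i j, i ≠ j → ¬ reachIn w Kᶜ (x i) (x j))

/-- `Lip(1,K)`: functions that are 1-Lipschitz on `K`. -/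
def Lip1On (d : V → V → ℝ) (K : Set V) (f : V → ℝ) : Prop :=
  ∀ x ∈ K, ∀ y ∈ K, f y - f x ≤ d x y

open Classical in
/-- The extremal Lipschitz extension operator `S(P)` of the salami partition
`P = (X,Y,K)`. -/
noncomputable def Sop (d : V → V → ℝ) (X Y K : Set V) (f : V → ℝ) : V → ℝ :=
  fun v =>
    if v ∈ K then f v
    else if v ∈ X then sSup {c | ∃ u ∈ K, c = f u - d v u}
    else sInf {c | ∃ u ∈ K, c = f u + d v u}

/-- `ℱ(P) = S(P)(Lip(1,K))`. -/
def calF (d : V → V → ℝ) (X Y K : Set V) : Set (V → ℝ) :=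
  {g | ∃ f : V → ℝ, Lip1On d K f ∧ g = Sop d X Y K f}

/-- `ℋ(P)`: the harmonic functions in `ℱ(P)`. -/
def calH (w : V → V → ℝ) (m : V → ℝ) (d : V → V → ℝ) (X Y K : Set V) :
    Set (V → ℝ) :=
  {g | g ∈ calF d X Y K ∧ ∀ x, lap w m g x = 0}

/-- `∇₊f(x) = max_{y∼x} (f(y)-f(x))/d(x,y)`. -/
noncomputable def gradPlus (w : V → V → ℝ) (d : V → V → ℝ) (f : V → ℝ) (x : V) : ℝ :=
  sSup {c | ∃ y, 0 < w x y ∧ c = (f y - f x) / d x y}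

/-- `∇₋f(x) = max_{y∼x} (f(x)-f(y))/d(x,y)`. -/
noncomputable def gradMinus (w : V → V → ℝ) (d : V → V → ℝ) (f : V → ℝ) (x : V) : ℝ :=
  sSup {c | ∃ y, 0 < w x y ∧ c = (f x - f y) / d x y}

/-- `|∇f|(x) = max_{y∼x} |f(y)-f(x)|/d(x,y)`. -/
noncomputable def gradAbs (w : V → V → ℝ) (d : V → V → ℝ) (f : V → ℝ) (x : V) : ℝ :=
  sSup {c | ∃ y, 0 < w x y ∧ c = |f y - f x| / d x y}

/-- Recurrence: for every `ε > 0` there is a finitely supported `f` with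
`‖f‖∞ = 1` and `-⟨f, Δf⟩ < ε`. -/
def Recurrent (w : V → V → ℝ) (m : V → ℝ) : Prop :=
  ∀ ε : ℝ, 0 < ε → ∃ f : V → ℝ, (Function.support f).Finite ∧
    (∀ x, |f x| ≤ 1) ∧ (∃ x, |f x| = 1) ∧
    -(∑ᶠ x, f x * lap w m f x * m x) < ε

open Classical in
/-- `∑_{x,y : f(y) < 0 ≤ f(x)} w(x,y)(f(x)-f(y))`. -/
noncomputable def cutSum (w : V → V → ℝ) (f : V → ℝ) : ℝ :=
  ∑ᶠ p : V × V, if f p.2 < 0 ∧ 0 ≤ f p.1 then w p.1 p.2 * (f p.1 - f p.2) else 0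

/-- Subexponential growth: `max_{B_r(x)} |u| = e^{o(r)}` as `r → ∞`. -/
def SubexpGrowth (d : V → V → ℝ) (x : V) (u : V → ℝ) : Prop :=
  Filter.Tendsto
    (fun r : ℕ => Real.log (sSup {c | ∃ y, d x y ≤ (r : ℝ) ∧ c = |u y|}) / (r : ℝ))
    Filter.atTop (nhds 0)


/-- The facts about a locally finite graph with non-negative Ollivier curvature and combinatorial
distance `d` on which the uniqueness argument rests. -/
structure CombGraph (w : V → V → ℝ) (m : V → ℝ) (d : V → V → ℝ) : Prop where
  symm : ∀ x y, w x y = w y x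
  nonneg : ∀ x y, 0 ≤ w x y
  pos : ∀ x, 0 < m x
  locFin : LocallyFinite w
  self : ∀ x, d x x = 0
  comm : ∀ x y, d x y = d y x
  tri : ∀ x y z, d x z ≤ d x y + d y z
  balls : FiniteBalls d
  nat : ∀ x y, ∃ n : ℕ, d x y = n
  edge : ∀ x y, 0 < w x y → d x y = 1
  step : ∀ x y, x ≠ y → ∃ z, 0 < w x z ∧ d z y = d x y - 1
  lap_edge : ∀ h, Lip1 d h → ∀ x y, 0 < w x y → h y - h x = 1 → lap w m h y ≤ lap w m h x

section Laplacian

variable {w : V → V → ℝ} {m : V → ℝ}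

lemma lap_eq_sum (hn : ∀ x y, 0 ≤ w x y) (f : V → ℝ) (x : V) (T : Finset V)
    (hT : ∀ y, 0 < w x y → y ∈ T) :
    lap w m f x = (m x)⁻¹ * ∑ y ∈ T, w x y * (f y - f x) := by
  unfold lap
  congr 1
  apply finsum_eq_sum_of_support_subset
  intro y hy
  apply hT
  rcases (hn x y).lt_or_eq with h | h
  · exact h
  · exact absurd (by simp [← h]) hy

lemma lap_neg (f : V → ℝ) (x : V) : lap w m (fun y => -f y) x = -lap w m f x := by
  unfold lap
  rw [← mul_neg, ← finsum_neg_distrib]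
  congr 2
  ext y
  ring

lemma lap_add_const (f : V → ℝ) (c : ℝ) (x : V) :
    lap w m (fun y => f y + c) x = lap w m f x := by
  unfold lap
  simp

lemma lap_sub (hn : ∀ x y, 0 ≤ w x y) (hl : LocallyFinite w) (f g : V → ℝ) (x : V) :
    lap w m (fun y => f y - g y) x = lap w m f x - lap w m g x := by
  have hT : ∀ y, 0 < w x y → y ∈ (hl x).toFinset := fun y hy => by simpa using hy
  rw [lap_eq_sum hn _ x _ hT, lap_eq_sum hn _ x _ hT, lap_eq_sum hn _ x _ hT, ← mul_sub,
    ← Finset.sum_sub_distrib]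
  congr 1
  exact Finset.sum_congr rfl fun y _ => by ring

lemma continuous_lap (hn : ∀ x y, 0 ≤ w x y) (hl : LocallyFinite w) (x : V) :
    Continuous fun f : V → ℝ => lap w m f x := by
  have hT : ∀ y, 0 < w x y → y ∈ (hl x).toFinset := fun y hy => by simpa using hy
  simp_rw [fun f => lap_eq_sum (m := m) hn f x _ hT]
  fun_prop

lemma abs_lap_le (hn : ∀ x y, 0 ≤ w x y) (hm : ∀ x, 0 < m x) (hl : LocallyFinite w)
    (f : V → ℝ) (x : V) (hf : ∀ y, 0 < w x y → |f y - f x| ≤ 1) :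
    |lap w m f x| ≤ (m x)⁻¹ * ∑ y ∈ (hl x).toFinset, w x y := by
  have hT : ∀ y, 0 < w x y → y ∈ (hl x).toFinset := fun y hy => by simpa using hy
  rw [lap_eq_sum hn f x _ hT, abs_mul, abs_of_pos (inv_pos.2 (hm x))]
  refine mul_le_mul_of_nonneg_left ((Finset.abs_sum_le_sum_abs _ _).trans
    (Finset.sum_le_sum fun y hy => ?_)) (inv_pos.2 (hm x)).le
  rw [abs_mul, abs_of_nonneg (hn x y)]
  exact mul_le_of_le_one_right (hn x y) (hf y (by simpa using hy))

/-- The local maximum principle: a function that is subharmonic at a local maximum agrees with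
it on all neighbors. -/
lemma eq_of_isLocalMax (hn : ∀ x y, 0 ≤ w x y) (hm : ∀ x, 0 < m x) (hl : LocallyFinite w)
    {u : V → ℝ} {x : V} (hu : 0 ≤ lap w m u x) (hmax : ∀ y, 0 < w x y → u y ≤ u x)
    {y : V} (hy : 0 < w x y) : u y = u x := by
  have hT : ∀ y, 0 < w x y → y ∈ (hl x).toFinset := fun y hy => by simpa using hy
  rw [lap_eq_sum hn u x _ hT] at hu
  have h0 : 0 ≤ ∑ y ∈ (hl x).toFinset, w x y * (u y - u x) :=
    nonneg_of_mul_nonneg_right hu (inv_pos.2 (hm x))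
  have hle : ∀ z ∈ (hl x).toFinset, w x z * (u z - u x) ≤ 0 := fun z hz =>
    mul_nonpos_of_nonneg_of_nonpos (hn x z)
      (sub_nonpos.2 (hmax z (by simpa using hz)))
  have h1 := (Finset.sum_eq_zero_iff_of_nonpos hle).1
    (le_antisymm (Finset.sum_nonpos hle) h0) y (hT y hy)
  rcases mul_eq_zero.1 h1 with h | h <;> linarith

end Laplacian

section CombDist

variable {w : V → V → ℝ} {m : V → ℝ}

lemma combDist_le {x y : V} {n : ℕ} (p : ℕ → V) (h0 : p 0 = x) (hp : p n = y)
    (he : ∀ i < n, 0 < w (p i) (p (i + 1))) : combDist w x y ≤ n := by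
  refine csInf_le ⟨0, ?_⟩ ⟨n, p, h0, hp, he, rfl⟩
  rintro _ ⟨k, _, _, _, _, rfl⟩
  exact Nat.cast_nonneg k

lemma exists_path (hc : GraphConnected w) (x y : V) :
    ∃ (n : ℕ) (p : ℕ → V), p 0 = x ∧ p n = y ∧ ∀ i < n, 0 < w (p i) (p (i + 1)) := by
  induction hc x y using Relation.ReflTransGen.head_induction_on with
  | refl => exact ⟨0, fun _ => y, rfl, rfl, by simp⟩
  | @head a _ hab _ ih =>
    obtain ⟨n, p, h0, hn, hp⟩ := ih
    refine ⟨n + 1, fun i => Nat.casesOn i a p, rfl, hn, ?_⟩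
    rintro (_ | i) hi
    · simpa [h0] using hab
    · exact hp i (by omega)

lemma exists_path_combDist (hc : GraphConnected w) (x y : V) :
    ∃ (n : ℕ) (p : ℕ → V), p 0 = x ∧ p n = y ∧ (∀ i < n, 0 < w (p i) (p (i + 1))) ∧
      combDist w x y = n := by
  classical
  have hex := exists_path hc x y
  obtain ⟨p, h0, hn, hp⟩ := Nat.find_spec hex
  refine ⟨Nat.find hex, p, h0, hn, hp, le_antisymm (combDist_le p h0 hn hp) ?_⟩
  refine le_csInf ⟨_, _, p, h0, hn, hp, rfl⟩ ?_
  rintro _ ⟨k, q, hq0, hqk, hq, rfl⟩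
  exact_mod_cast Nat.find_min' hex ⟨q, hq0, hqk, hq⟩

lemma combDist_edge (hb : IsGraphBase w m (combDist w)) {x y : V} (h : 0 < w x y) :
    combDist w x y = 1 := by
  obtain ⟨-, -, -, hdiag, -, -, hc, ⟨-, hpos, -⟩, -⟩ := hb
  have hne : x ≠ y := by
    rintro rfl
    exact h.ne' (hdiag x)
  have hle : combDist w x y ≤ (1 : ℕ) :=
    combDist_le (fun i => Nat.casesOn i x fun _ => y) rfl rfl (by
      intro i hi
      obtain rfl : i = 0 := by omega
      exact h)
  obtain ⟨n, -, -, -, -, hd⟩ := exists_path_combDist hc x y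
  have h0 := hpos x y hne
  rw [hd] at h0 hle ⊢
  have h1 : 0 < n := by exact_mod_cast h0
  have h2 : n ≤ 1 := by exact_mod_cast hle
  exact_mod_cast (by omega : n = 1)

lemma combGraph_of_isSalami (hS : IsSalami w m (combDist w)) :
    CombGraph w m (combDist w) := by
  obtain ⟨hb, hk, -⟩ := hS
  have hb' := hb
  obtain ⟨-, hsymm, hn, hdiag, hm, hl, hc, ⟨hself, hpos, hcomm, htri, -⟩, hballs⟩ := hb'
  have hedge : ∀ x y, 0 < w x y → combDist w x y = 1 := fun x y => combDist_edge hb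
  refine ⟨hsymm, hn, hm, hl, hself, hcomm, htri, hballs, ?_, hedge, ?_, ?_⟩
  · intro x y
    obtain ⟨n, -, -, -, -, hd⟩ := exists_path_combDist hc x y
    exact ⟨n, hd⟩
  · intro x y hxy
    obtain ⟨n, p, h0, hpn, hp, hd⟩ := exists_path_combDist hc x y
    obtain _ | n := n
    · exact absurd (h0.symm.trans hpn) hxy
    · have hw : 0 < w x (p 1) := by simpa [h0] using hp 0 (by omega)
      refine ⟨p 1, hw, ?_⟩
      have h1 : combDist w (p 1) y ≤ n :=
        combDist_le (fun i => p (i + 1)) rfl hpn fun i hi => hp (i + 1) (by omega)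
      have h2 := htri x (p 1) y
      rw [hedge _ _ hw] at h2
      push_cast at hd
      linarith
  · intro h hh x y hxy he
    have hlip : ∀ f, Lip1 (combDist w) f → ∀ a b, 0 < w a b → |f b - f a| ≤ 1 := by
      intro f hf a b hab
      have h1 := hf a b
      have h2 := hf b a
      rw [hcomm b a, hedge a b hab] at h2
      rw [hedge a b hab] at h1
      exact abs_le.2 ⟨by linarith, h1⟩
    have hbd : BddBelow {c | ∃ f : V → ℝ, Lip1 (combDist w) f ∧ f y - f x = combDist w x y ∧
        c = lap w m f x - lap w m f y} := by
      refine ⟨-((m x)⁻¹ * ∑ z ∈ (hl x).toFinset, w x z) -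
        (m y)⁻¹ * ∑ z ∈ (hl y).toFinset, w y z, ?_⟩
      rintro _ ⟨f, hf, -, rfl⟩
      have h1 := (abs_le.1 (abs_lap_le hn hm hl f x (hlip f hf x))).1
      have h2 := (abs_le.1 (abs_lap_le hn hm hl f y (hlip f hf y))).2
      linarith
    have h0 := hk x y hxy
    unfold kappa at h0
    have hd := hedge x y hxy
    have h1 := csInf_le hbd ⟨h, hh, by rw [he, hd], rfl⟩
    have h2 := nonneg_of_mul_nonneg_right h0 (by rw [hd]; norm_num)
    linarith

end CombDist

namespace CombGraph

variable {w : V → V → ℝ} {m : V → ℝ} {d : V → V → ℝ} (G : CombGraph w m d)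
include G

lemma dist_nonneg (x y : V) : 0 ≤ d x y := by
  obtain ⟨n, hn⟩ := G.nat x y
  exact hn ▸ n.cast_nonneg

lemma induction_dist (y : V) {P : V → Prop} (hy : P y)
    (ih : ∀ x z, 0 < w x z → d z y = d x y - 1 → P z → P x) (x : V) : P x := by
  obtain ⟨n, hn⟩ := G.nat x y
  induction n generalizing x with
  | zero =>
    by_cases hxy : x = y
    · exact hxy ▸ hy
    · obtain ⟨z, -, hz⟩ := G.step x y hxy
      have := G.dist_nonneg z y
      push_cast at hn
      linarith
  | succ n hind =>
    by_cases hxy : x = y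
    · exact hxy ▸ hy
    · obtain ⟨z, hw, hz⟩ := G.step x y hxy
      exact ih x z hw hz (hind z (by rw [hz, hn]; push_cast; ring))

lemma lip_of_edge {f : V → ℝ} (hf : ∀ x y, 0 < w x y → f y - f x ≤ 1) : Lip1 d f := by
  intro x y
  refine G.induction_dist y (P := fun x => f y - f x ≤ d x y) (by simp [G.self]) ?_ x
  intro x z hw hz h
  have := hf x z hw
  linarith

lemma lip_neg {f : V → ℝ} (hf : Lip1 d f) : Lip1 d fun x => -f x := by
  intro x y
  have := hf y x
  rw [G.comm y x] at this
  linarith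

/-- The Laplacian of a 1-Lipschitz function decreases along the gradient geodesics. -/
lemma lap_le_of_dist {h : V → ℝ} (hh : Lip1 d h) {x y : V} (hxy : h y - h x = d x y) :
    lap w m h y ≤ lap w m h x := by
  refine G.induction_dist y
    (P := fun x => h y - h x = d x y → lap w m h y ≤ lap w m h x) (fun _ => le_rfl) ?_ x hxy
  intro x z hw hz hind hx
  have h1 := hh x z
  have h2 := hh z y
  rw [G.edge x z hw] at h1
  exact (hind (by linarith)).trans (G.lap_edge h hh x z hw (by linarith))

/-- A set that is closed under adjacency is empty or everything. -/
lemma forall_of_closed {P : V → Prop} (hP : ∀ x y, 0 < w x y → P x → P y) {x₀ : V}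
    (h₀ : P x₀) (x : V) : P x :=
  G.induction_dist x₀ h₀ (fun x z hw _ hz => hP z x (by rwa [G.symm]) hz) x

/-- Balls are connected. -/
lemma forall_ball_of_closed {P : V → Prop} {x₀ : V} {R : ℝ}
    (hP : ∀ x y, d x x₀ ≤ R → d y x₀ ≤ R → 0 < w x y → P x → P y)
    {u : V} (hu : d u x₀ ≤ R) (hPu : P u) (x : V) (hx : d x x₀ ≤ R) : P x := by
  have h₀ : P x₀ := by
    refine G.induction_dist x₀ (P := fun x => d x x₀ ≤ R → P x → P x₀) (fun _ h => h) ?_ u hu hPu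
    intro x z hw hz hind hxR hPx
    exact hind (by linarith) (hP x z hxR (by linarith) hw hPx)
  refine G.induction_dist x₀ (P := fun x => d x x₀ ≤ R → P x) (fun _ => h₀) ?_ x hx
  intro x z hw hz hind hxR
  exact hP z x (by linarith) hxR (by rwa [G.symm]) (hind (by linarith))

end CombGraph

/-- `f` is the extremal Lipschitz extension of its restriction to `K`: the smallest one on `A` and
the largest one on `B`. -/
def IsExtremal (d : V → V → ℝ) (A B K : Set V) (f : V → ℝ) : Prop :=
  Lip1 d f ∧ (∀ v ∈ A, ∃ u ∈ K, f v = f u - d v u) ∧ (∀ v ∈ B, ∃ u ∈ K, f v = f u + d v u)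

section Extremal

variable {w : V → V → ℝ} {m : V → ℝ} {d : V → V → ℝ} {A B K : Set V} {f : V → ℝ}

lemma IsExtremal.add_const (hf : IsExtremal d A B K f) (c : ℝ) :
    IsExtremal d A B K fun x => f x + c := by
  refine ⟨fun x y => ?_, fun v hv => ?_, fun v hv => ?_⟩
  · have := hf.1 x y
    linarith
  · obtain ⟨u, hu, h⟩ := hf.2.1 v hv
    exact ⟨u, hu, by linarith⟩
  · obtain ⟨u, hu, h⟩ := hf.2.2 v hv
    exact ⟨u, hu, by linarith⟩

lemma IsExtremal.neg (G : CombGraph w m d) (hf : IsExtremal d A B K f) :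
    IsExtremal d B A K fun x => -f x := by
  refine ⟨G.lip_neg hf.1, fun v hv => ?_, fun v hv => ?_⟩
  · obtain ⟨u, hu, h⟩ := hf.2.2 v hv
    exact ⟨u, hu, by linarith⟩
  · obtain ⟨u, hu, h⟩ := hf.2.1 v hv
    exact ⟨u, hu, by linarith⟩

lemma IsExtremal.add_le (G : CombGraph w m d) (hcov : A ∪ B ∪ K = Set.univ) {f' : V → ℝ}
    (hf : IsExtremal d A B K f) (hf' : IsExtremal d A B K f') {c : ℝ}
    (hK : ∀ u ∈ K, f u + c ≤ f' u) (v : V) : f v + c ≤ f' v := by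
  have hv : v ∈ A ∪ B ∪ K := hcov ▸ Set.mem_univ v
  rcases hv with (hv | hv) | hv
  · obtain ⟨u, hu, h⟩ := hf.2.1 v hv
    have h1 := hf'.1 v u
    have h2 := hK u hu
    linarith
  · obtain ⟨u, hu, h⟩ := hf'.2.2 v hv
    have h1 := hf.1 u v
    have h2 := hK u hu
    rw [G.comm u v] at h1
    linarith
  · exact hK v hv

/-- Lipschitz functions on `K` have extremal extensions. -/
lemma exists_isExtremal (G : CombGraph w m d) (hcov : A ∪ B ∪ K = Set.univ)
    (hAB : ∀ a ∈ A, ∀ b ∈ B, w a b = 0) (hBK : Disjoint B K) (hA : Disjoint A B)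
    (hK : K.Finite) (hne : K.Nonempty) {φ : V → ℝ} (hφ : Lip1On d K φ) :
    ∃ F, IsExtremal d A B K F ∧ ∀ u ∈ K, F u = φ u := by
  classical
  choose p hpK hp using fun v => Set.exists_max_image K (fun u => φ u - d v u) hK hne
  choose q hqK hq using fun v => Set.exists_min_image K (fun u => φ u + d v u) hK hne
  have hpe : ∀ u ∈ K, φ (p u) - d u (p u) = φ u := fun u hu =>
    le_antisymm (by linarith [hφ u hu _ (hpK u)]) (by simpa [G.self] using hp u u hu)
  have hqe : ∀ u ∈ K, φ (q u) + d u (q u) = φ u := fun u hu =>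
    le_antisymm (by simpa [G.self] using hq u u hu)
      (by linarith [hφ _ (hqK u) u hu, G.comm u (q u)])
  let F : V → ℝ := fun v => if v ∈ B then φ (q v) + d v (q v) else φ (p v) - d v (p v)
  have hFB : ∀ v ∈ B, F v = φ (q v) + d v (q v) := fun v hv => if_pos hv
  have hFA : ∀ v, v ∉ B → F v = φ (p v) - d v (p v) := fun v hv => if_neg hv
  have hFK : ∀ u ∈ K, F u = φ u := fun u hu =>
    (hFA u (fun h => hBK.le_bot ⟨h, hu⟩)).trans (hpe u hu)
  have hFK' : ∀ u ∈ K, F u = φ (q u) + d u (q u) := fun u hu => (hFK u hu).trans (hqe u hu).symm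
  refine ⟨F, ⟨G.lip_of_edge fun x y hxy => ?_, fun v hv => ?_, fun v hv => ?_⟩, hFK⟩
  · have hlow : F x = φ (p x) - d x (p x) → F y = φ (p y) - d y (p y) → F y - F x ≤ 1 := by
      intro hx hy
      have h1 := hp x (p y) (hpK y)
      have h2 := G.tri x y (p y)
      rw [G.edge x y hxy] at h2
      linarith
    have hup : F x = φ (q x) + d x (q x) → F y = φ (q y) + d y (q y) → F y - F x ≤ 1 := by
      intro hx hy
      have h1 := hq y (q x) (hqK x)
      have h2 := G.tri y x (q x)
      rw [G.comm y x, G.edge x y hxy] at h2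
      linarith
    have hK_of : ∀ a b, 0 < w a b → a ∈ B → b ∉ B → b ∈ K := by
      intro a b hab ha hb
      have hb' : b ∈ A ∪ B ∪ K := hcov ▸ Set.mem_univ b
      rcases hb' with (h | h) | h
      · rw [G.symm, hAB b h a ha] at hab
        exact absurd hab (lt_irrefl _)
      · exact absurd h hb
      · exact h
    by_cases hx : x ∈ B <;> by_cases hy : y ∈ B
    · exact hup (hFB x hx) (hFB y hy)
    · exact hup (hFB x hx) (hFK' y (hK_of x y hxy hx hy))
    · exact hup (hFK' x (hK_of y x (by rwa [G.symm]) hy hx)) (hFB y hy)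
    · exact hlow (hFA x hx) (hFA y hy)
  · refine ⟨p v, hpK v, ?_⟩
    rw [hFK _ (hpK v), hFA v fun h => hA.le_bot ⟨hv, h⟩]
  · refine ⟨q v, hqK v, ?_⟩
    rw [hFK _ (hqK v), hFB v hv]

lemma IsExtremal.le_lap (G : CombGraph w m d) (hf : IsExtremal d A B K f) {c : ℝ}
    (hc : ∀ u ∈ K, c ≤ lap w m f u) : ∀ v ∈ A, c ≤ lap w m f v := by
  intro v hv
  obtain ⟨u, hu, h⟩ := hf.2.1 v hv
  exact (hc u hu).trans (G.lap_le_of_dist hf.1 (by linarith))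

lemma IsExtremal.lap_le (G : CombGraph w m d) (hf : IsExtremal d A B K f) {c : ℝ}
    (hc : ∀ u ∈ K, lap w m f u ≤ c) : ∀ v ∈ B, lap w m f v ≤ c := by
  intro v hv
  obtain ⟨u, hu, h⟩ := hf.2.2 v hv
  exact (G.lap_le_of_dist hf.1 (by rw [G.comm u v]; linarith)).trans (hc u hu)

lemma IsExtremal.finite_le (G : CombGraph w m d) (hK : K.Finite)
    (hf : IsExtremal d A B K f) (t : ℝ) : {v ∈ B | f v ≤ t}.Finite := by
  refine (hK.biUnion fun u _ => G.balls u (t - f u)).subset ?_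
  rintro v ⟨hv, hvt⟩
  obtain ⟨u, hu, h⟩ := hf.2.2 v hv
  simp only [Set.mem_iUnion, Set.mem_ofPred_eq]
  exact ⟨u, hu, by rw [G.comm u v]; linarith⟩

/-- A small step of the heat flow preserves Lipschitz functions on a finite set. -/
lemma exists_lip1On_add_mul_lap (G : CombGraph w m d) (hK : K.Finite) (hf : Lip1 d f) :
    ∃ ε > 0, Lip1On d K (fun x => f x + ε * lap w m f x) ∧
      ∀ u ∈ K, ε * ((m u)⁻¹ * ∑ y ∈ (G.locFin u).toFinset, w u y) < 1 := by
  have key : ∀ᶠ ε : ℝ in nhdsWithin 0 (Set.Ioi 0), (∀ x ∈ K, ∀ y ∈ K,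
      (f y + ε * lap w m f y) - (f x + ε * lap w m f x) ≤ d x y) ∧
      ∀ u ∈ K, ε * ((m u)⁻¹ * ∑ y ∈ (G.locFin u).toFinset, w u y) < 1 := by
    refine .and ?_ ?_
    · rw [Filter.eventually_all_finite hK]
      intro x _
      rw [Filter.eventually_all_finite hK]
      intro y _
      rcases (hf x y).lt_or_eq with h | h
      · have hcont : Continuous fun ε : ℝ =>
            (f y + ε * lap w m f y) - (f x + ε * lap w m f x) := by fun_prop
        have := (hcont.tendsto 0).eventually (gt_mem_nhds (by simpa using h : _ < d x y))
        exact (this.filter_mono nhdsWithin_le_nhds).mono fun _ => le_of_lt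
      · filter_upwards [self_mem_nhdsWithin] with ε hε
        have := mul_le_mul_of_nonneg_left (G.lap_le_of_dist hf h) (le_of_lt hε)
        linarith
    · rw [Filter.eventually_all_finite hK]
      intro u _
      have hcont : Continuous fun ε : ℝ =>
          ε * ((m u)⁻¹ * ∑ y ∈ (G.locFin u).toFinset, w u y) := by fun_prop
      have := (hcont.tendsto 0).eventually (gt_mem_nhds (by simp : _ < (1 : ℝ)))
      exact this.filter_mono nhdsWithin_le_nhds
  obtain ⟨ε, hε, h0⟩ := (key.and self_mem_nhdsWithin).exists
  exact ⟨ε, h0, hε⟩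

/-- One step of the extremal heat flow preserves lower bounds on the Laplacian, and spreads
strictness of the bound to neighbors. -/
lemma exists_isExtremal_step (G : CombGraph w m d) (hcov : A ∪ B ∪ K = Set.univ)
    (hAB : ∀ a ∈ A, ∀ b ∈ B, w a b = 0) (hBK : Disjoint B K) (hA : Disjoint A B)
    (hK : K.Finite) (hne : K.Nonempty) (hf : IsExtremal d A B K f) {c : ℝ}
    (hc : ∀ u ∈ K, c ≤ lap w m f u) :
    ∃ f', IsExtremal d A B K f' ∧ (∀ u ∈ K, c ≤ lap w m f' u) ∧
      ∀ u ∈ K, lap w m f' u = c →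
        lap w m f u = c ∧ ∀ y ∈ K, 0 < w u y → lap w m f y = c := by
  obtain ⟨ε, hε, hlip, hdeg⟩ := exists_lip1On_add_mul_lap (m := m) G hK hf.1
  obtain ⟨f', hf', hK'⟩ := exists_isExtremal G hcov hAB hBK hA hK hne hlip
  have hge : ∀ v, f v + ε * c ≤ f' v := hf.add_le G hcov hf' fun u hu => by
    rw [hK' u hu]
    linarith [mul_le_mul_of_nonneg_left (hc u hu) hε.le]
  have hid : ∀ u ∈ K, lap w m f' u - c =
      (lap w m f u - c) * (1 - ε * ((m u)⁻¹ * ∑ y ∈ (G.locFin u).toFinset, w u y)) +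
      (m u)⁻¹ * ∑ y ∈ (G.locFin u).toFinset, w u y * (f' y - (f y + ε * c)) := by
    intro u hu
    have hT : ∀ y, 0 < w u y → y ∈ (G.locFin u).toFinset := fun y hy => by simpa using hy
    have h1 : ∑ y ∈ (G.locFin u).toFinset, w u y * (f' y - f' u) =
        ∑ y ∈ (G.locFin u).toFinset, w u y * (f y - f u) +
        ∑ y ∈ (G.locFin u).toFinset, w u y * (f' y - (f y + ε * c)) -
        ε * (lap w m f u - c) * ∑ y ∈ (G.locFin u).toFinset, w u y := by
      rw [Finset.mul_sum, ← Finset.sum_add_distrib, ← Finset.sum_sub_distrib]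
      refine Finset.sum_congr rfl fun y _ => ?_
      rw [hK' u hu]
      ring
    have h2 : lap w m f u = (m u)⁻¹ * ∑ y ∈ (G.locFin u).toFinset, w u y * (f y - f u) :=
      lap_eq_sum G.nonneg f u _ hT
    rw [lap_eq_sum G.nonneg f' u _ hT, h1]
    linear_combination -h2
  have hs : ∀ u, ∀ y ∈ (G.locFin u).toFinset, 0 ≤ w u y * (f' y - (f y + ε * c)) := fun u y _ =>
    mul_nonneg (G.nonneg u y) (by linarith [hge y])
  have hS : ∀ u, 0 ≤ (m u)⁻¹ *
      ∑ y ∈ (G.locFin u).toFinset, w u y * (f' y - (f y + ε * c)) := fun u =>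
    mul_nonneg (inv_pos.2 (G.pos u)).le (Finset.sum_nonneg (hs u))
  have hP : ∀ u ∈ K, 0 ≤ (lap w m f u - c) *
      (1 - ε * ((m u)⁻¹ * ∑ y ∈ (G.locFin u).toFinset, w u y)) := fun u hu =>
    mul_nonneg (by linarith [hc u hu]) (by linarith [hdeg u hu])
  refine ⟨f', hf', fun u hu => ?_, fun u hu heq => ?_⟩
  · linarith [hid u hu, hS u, hP u hu]
  · have h1 := hid u hu
    have hP0 := hP u hu
    have hS0 := hS u
    refine ⟨?_, fun y hy hw => ?_⟩
    · have : (lap w m f u - c) *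
          (1 - ε * ((m u)⁻¹ * ∑ y ∈ (G.locFin u).toFinset, w u y)) = 0 := by linarith
      rcases mul_eq_zero.1 this with h | h
      · linarith
      · linarith [hdeg u hu]
    · have h2 : (m u)⁻¹ *
          ∑ y ∈ (G.locFin u).toFinset, w u y * (f' y - (f y + ε * c)) = 0 := by linarith
      have h3 := (mul_eq_zero.1 h2).resolve_left (inv_pos.2 (G.pos u)).ne'
      have h4 := (Finset.sum_eq_zero_iff_of_nonneg (hs u)).1 h3 y (by simpa using hw)
      have h5 := (mul_eq_zero.1 h4).resolve_left hw.ne'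
      rw [hK' y hy] at h5
      have h6 : ε * (lap w m f y - c) = 0 := by linarith
      linarith [(mul_eq_zero.1 h6).resolve_left hε.ne']

lemma isCompact_isExtremal (G : CombGraph w m d) (hK : K.Finite) (x₀ : V) :
    IsCompact {f : V → ℝ | IsExtremal d A B K f ∧ f x₀ = 0} := by
  refine (isCompact_univ_pi fun v => isCompact_Icc (a := -d x₀ v) (b := d x₀ v)).of_isClosed_subset
    ?_ ?_
  · refine .inter (.inter ?_ (.inter ?_ ?_)) ?_
    · change IsClosed {f : V → ℝ | ∀ x y, f y - f x ≤ d x y}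
      simp only [Set.ofPred_forall]
      exact isClosed_iInter fun x => isClosed_iInter fun y =>
        isClosed_le (by fun_prop) continuous_const
    · change IsClosed {f : V → ℝ | ∀ v ∈ A, ∃ u ∈ K, f v = f u - d v u}
      have : {f : V → ℝ | ∀ v ∈ A, ∃ u ∈ K, f v = f u - d v u} =
          ⋂ v ∈ A, ⋃ u ∈ K, {f : V → ℝ | f v = f u - d v u} := by
        ext f
        simp
      rw [this]
      exact isClosed_biInter fun v _ => hK.isClosed_biUnion fun u _ =>
        isClosed_eq (by fun_prop) (by fun_prop)
    · change IsClosed {f : V → ℝ | ∀ v ∈ B, ∃ u ∈ K, f v = f u + d v u}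
      have : {f : V → ℝ | ∀ v ∈ B, ∃ u ∈ K, f v = f u + d v u} =
          ⋂ v ∈ B, ⋃ u ∈ K, {f : V → ℝ | f v = f u + d v u} := by
        ext f
        simp
      rw [this]
      exact isClosed_biInter fun v _ => hK.isClosed_biUnion fun u _ =>
        isClosed_eq (by fun_prop) (by fun_prop)
    · exact isClosed_eq (by fun_prop) continuous_const
  · rintro f ⟨hf, h0⟩ v -
    have h1 := hf.1 x₀ v
    have h2 := hf.1 v x₀
    rw [G.comm v x₀] at h2
    exact ⟨by linarith, by linarith⟩

/-- On a ball there is an extremal function with constant Laplacian. -/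
lemma exists_isExtremal_lap_eq_const (G : CombGraph w m d) {x₀ : V} {R : ℝ} (hR : 0 ≤ R)
    (hcov : A ∪ B ∪ {x | d x x₀ ≤ R} = Set.univ)
    (hAB : ∀ a ∈ A, ∀ b ∈ B, w a b = 0) (hBK : Disjoint B {x | d x x₀ ≤ R})
    (hA : Disjoint A B) :
    ∃ f c, IsExtremal d A B {x | d x x₀ ≤ R} f ∧ ∀ u, d u x₀ ≤ R → lap w m f u = c := by
  classical
  have hK : {x | d x x₀ ≤ R}.Finite := by
    simpa only [G.comm _ x₀] using G.balls x₀ R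
  have hx₀ : d x₀ x₀ ≤ R := by rwa [G.self]
  have hne : {x | d x x₀ ≤ R}.Nonempty := ⟨x₀, hx₀⟩
  set K := {x | d x x₀ ≤ R} with hKdef
  have hnorm : ∀ f, IsExtremal d A B K f → IsExtremal d A B K (fun x => f x + -f x₀) ∧
      f x₀ + -f x₀ = 0 := fun f hf => ⟨hf.add_const _, by ring⟩
  have hFne : hK.toFinset.Nonempty := by simpa using hne
  have hcont : Continuous fun f : V → ℝ => hK.toFinset.inf' hFne fun u => lap w m f u :=
    Continuous.finset_inf'_apply hFne fun u _ => continuous_lap G.nonneg G.locFin u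
  have hinh : {f : V → ℝ | IsExtremal d A B K f ∧ f x₀ = 0}.Nonempty := by
    obtain ⟨F, hF, -⟩ := exists_isExtremal G hcov hAB hBK hA hK hne (φ := fun _ => 0)
      (fun x _ y _ => by simpa using G.dist_nonneg x y)
    exact ⟨_, hnorm F hF⟩
  obtain ⟨f₀, ⟨hf₀, -⟩, hmax⟩ :=
    (isCompact_isExtremal G hK x₀).exists_isMaxOn hinh hcont.continuousOn
  set c := hK.toFinset.inf' hFne fun u => lap w m f₀ u with hcdef
  have hf₀c : ∀ u ∈ K, c ≤ lap w m f₀ u := fun u hu =>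
    Finset.inf'_le (fun u => lap w m f₀ u) (by simpa using hu)
  have hex : ∀ f, IsExtremal d A B K f → ∃ u ∈ K, lap w m f u ≤ c := by
    intro f hf
    have h1 := hmax (hnorm f hf)
    obtain ⟨u, hu, h⟩ := Finset.exists_mem_eq_inf' hFne
      fun u => lap w m (fun x => f x + -f x₀) u
    refine ⟨u, by simpa using hu, ?_⟩
    rw [← lap_add_const f (-f x₀), ← h]
    exact h1
  have main : ∀ n : ℕ, ∀ f, IsExtremal d A B K f → (∀ u ∈ K, c ≤ lap w m f u) →
      {u ∈ K | lap w m f u = c}.ncard = n →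
      ∃ f c, IsExtremal d A B K f ∧ ∀ u ∈ K, lap w m f u = c := by
    intro n
    induction n using Nat.strong_induction_on with
    | _ n ih =>
      intro f hf hfc hn
      by_cases hall : ∀ u ∈ K, lap w m f u = c
      · exact ⟨f, c, hf, hall⟩
      obtain ⟨f', hf', hfc', hst⟩ := exists_isExtremal_step G hcov hAB hBK hA hK hne hf hfc
      refine ih _ ?_ f' hf' hfc' rfl
      rw [← hn]
      refine Set.ncard_lt_ncard ?_ (hK.subset (Set.sep_subset _ _))
      refine ⟨fun u hu => ⟨hu.1, (hst u hu.1 hu.2).1⟩, fun hsub => hall ?_⟩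
      obtain ⟨u, hu, hle⟩ := hex f hf
      refine G.forall_ball_of_closed (P := fun u => lap w m f u = c) ?_ hu
        (le_antisymm hle (hfc u hu))
      intro x y hx hy hw hxc
      exact (hst x hx (hsub ⟨hx, hxc⟩).2).2 y hy hw
  exact main _ f₀ hf₀ hf₀c rfl

end Extremal

section Volume

variable {w : V → V → ℝ} {m : V → ℝ} {d : V → V → ℝ} {A B K : Set V}

lemma InfVolume.not_finite (hA : InfVolume m A) (hm : ∀ x, 0 < m x) : ¬A.Finite := by
  intro hfin
  obtain ⟨F, hF, hlt⟩ := hA (∑ x ∈ hfin.toFinset, m x)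
  refine hlt.not_ge (Finset.sum_le_sum_of_subset_of_nonneg (fun x hx => ?_) fun x _ _ => (hm x).le)
  simpa using hF hx

lemma InfVolume.mono (hA : InfVolume m A) (h : A ⊆ B) : InfVolume m B := fun c =>
  let ⟨F, hF, hlt⟩ := hA c
  ⟨F, hF.trans h, hlt⟩

lemma InfVolume.of_union (h : InfVolume m (A ∪ B)) : InfVolume m A ∨ InfVolume m B := by
  classical
  by_contra! hcon
  simp only [InfVolume, not_forall, not_exists, not_and, not_lt] at hcon
  obtain ⟨⟨a, ha⟩, b, hb⟩ := hcon
  obtain ⟨F, hF, hlt⟩ := h (a + b)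
  rw [← Finset.sum_filter_add_sum_filter_not F (· ∈ A)] at hlt
  have h1 := ha (F.filter (· ∈ A)) (by simp [Set.subset_def])
  have h2 := hb (F.filter (· ∉ A)) (by
    intro x hx
    simp only [Finset.coe_filter, Set.mem_ofPred_eq] at hx
    exact (hF hx.1).resolve_left hx.2)
  linarith

lemma InfVolume.diff (hA : InfVolume m A) (hm : ∀ x, 0 < m x) (hK : K.Finite) :
    InfVolume m (A \ K) := by
  have : InfVolume m (A \ K ∪ K) := hA.mono fun x hx => by
    by_cases h : x ∈ K
    · exact Or.inr h
    · exact Or.inl ⟨hx, h⟩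
  exact this.of_union.resolve_right fun h => h.not_finite hm hK

/-- A Lipschitz function tending to infinity on a set of infinite volume with finite boundary
cannot have Laplacian bounded above by a negative constant there. -/
lemma not_lap_le_neg (G : CombGraph w m d) (hK : K.Finite)
    (hBK : ∀ x ∈ B, ∀ y, 0 < w x y → y ∈ B ∨ y ∈ K) (hB : InfVolume m B) {h : V → ℝ}
    (hlip : Lip1 d h) (hprop : ∀ t, {v ∈ B | h v ≤ t}.Finite) {c : ℝ} (hc : c < 0)
    (hlap : ∀ v ∈ B, lap w m h v ≤ c) : False := by
  classical
  set C := ∑ y ∈ hK.toFinset, ∑ x ∈ (G.locFin y).toFinset, w y x with hC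
  obtain ⟨F₀, hF₀, hlt⟩ := hB (C / -c)
  obtain ⟨t, ht⟩ : ∃ t, ∀ x ∈ F₀, h x ≤ t := by
    obtain ⟨t, ht⟩ := (F₀.finite_toSet.image h).bddAbove
    exact ⟨t, fun x hx => ht ⟨x, hx, rfl⟩⟩
  set F := (hprop t).toFinset with hFdef
  have hF : ∀ x, x ∈ F ↔ x ∈ B ∧ h x ≤ t := fun x => by simp [hFdef]
  have hF₀F : F₀ ⊆ F := fun x hx => (hF x).2 ⟨hF₀ hx, ht x hx⟩
  have hpt : ∀ x ∈ F, ∑ y ∈ F, w x y * (h y - h x) - ∑ y ∈ hK.toFinset, w x y ≤ m x * c := by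
    intro x hx
    have hxB := ((hF x).1 hx).1
    have hxt := ((hF x).1 hx).2
    set T := F ∪ (G.locFin x).toFinset with hT
    have h1 : m x * lap w m h x = ∑ y ∈ T, w x y * (h y - h x) := by
      rw [lap_eq_sum G.nonneg h x T fun y hy => Finset.mem_union_right _ (by simpa using hy),
        mul_inv_cancel_left₀ (G.pos x).ne']
    have h2 : ∑ y ∈ T \ F, w x y * (h y - h x) + ∑ y ∈ F, w x y * (h y - h x) =
        ∑ y ∈ T, w x y * (h y - h x) := Finset.sum_sdiff Finset.subset_union_left
    have h3 : ∑ y ∈ T \ F, -(if y ∈ K then w x y else 0) ≤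
        ∑ y ∈ T \ F, w x y * (h y - h x) := by
      refine Finset.sum_le_sum fun y hy => ?_
      have hyF : y ∉ F := (Finset.mem_sdiff.1 hy).2
      have hw : 0 < w x y := by
        have := (Finset.mem_union.1 (Finset.mem_sdiff.1 hy).1).resolve_left hyF
        simpa using this
      split_ifs with hyK
      · have := hlip y x
        rw [G.comm, G.edge x y hw] at this
        nlinarith
      · have hyB := (hBK x hxB y hw).resolve_right hyK
        have : t < h y := by
          by_contra! hcon
          exact hyF ((hF y).2 ⟨hyB, hcon⟩)
        rw [neg_zero]
        exact mul_nonneg hw.le (by linarith)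
    have h4 : ∑ y ∈ T \ F, (if y ∈ K then w x y else 0) ≤ ∑ y ∈ hK.toFinset, w x y := by
      rw [← Finset.sum_filter]
      exact Finset.sum_le_sum_of_subset_of_nonneg (fun y hy => by simpa using (Finset.mem_filter.1 hy).2)
        fun y _ _ => G.nonneg x y
    rw [Finset.sum_neg_distrib] at h3
    have h5 := mul_le_mul_of_nonneg_left (hlap x hxB) (G.pos x).le
    linarith
  have hsum := Finset.sum_le_sum hpt
  rw [Finset.sum_sub_distrib, ← Finset.sum_mul] at hsum
  have hanti : ∑ x ∈ F, ∑ y ∈ F, w x y * (h y - h x) = 0 := by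
    have h1 : ∑ x ∈ F, ∑ y ∈ F, w x y * (h y - h x) =
        -∑ x ∈ F, ∑ y ∈ F, w x y * (h y - h x) := by
      conv_lhs => rw [Finset.sum_comm]
      rw [← Finset.sum_neg_distrib]
      refine Finset.sum_congr rfl fun x _ => ?_
      rw [← Finset.sum_neg_distrib]
      refine Finset.sum_congr rfl fun y _ => ?_
      rw [G.symm y x]
      ring
    linarith
  have hbd : ∑ x ∈ F, ∑ y ∈ hK.toFinset, w x y ≤ C := by
    rw [Finset.sum_comm]
    refine Finset.sum_le_sum fun y _ => ?_
    calc ∑ x ∈ F, w x y = ∑ x ∈ F, w y x := Finset.sum_congr rfl fun x _ => G.symm x y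
      _ ≤ ∑ x ∈ F ∪ (G.locFin y).toFinset, w y x :=
        Finset.sum_le_sum_of_subset_of_nonneg Finset.subset_union_left fun x _ _ => G.nonneg y x
      _ = ∑ x ∈ (G.locFin y).toFinset, w y x := by
        refine (Finset.sum_subset Finset.subset_union_right fun x _ hx => ?_).symm
        simp only [Set.Finite.mem_toFinset, Set.mem_ofPred_eq, not_lt] at hx
        exact le_antisymm hx (G.nonneg y x)
  have hmono : ∑ x ∈ F₀, m x ≤ ∑ x ∈ F, m x :=
    Finset.sum_le_sum_of_subset_of_nonneg hF₀F fun x _ _ => (G.pos x).le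
  have h6 := (div_lt_iff₀ (neg_pos.2 hc)).1 (hlt.trans_le hmono)
  linarith

end Volume

/-- Two disjoint, non-adjacent sets of infinite volume that together are cofinite. -/
structure IsSplit (w : V → V → ℝ) (m : V → ℝ) (A B : Set V) : Prop where
  disj : Disjoint A B
  cofin : (A ∪ B)ᶜ.Finite
  sep : ∀ a ∈ A, ∀ b ∈ B, w a b = 0
  infLeft : InfVolume m A
  infRight : InfVolume m B

section Split

variable {w : V → V → ℝ} {m : V → ℝ} {d : V → V → ℝ} {A B X Y : Set V}

lemma IsSplit.symm (G : CombGraph w m d) (hs : IsSplit w m A B) : IsSplit w m B A :=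
  ⟨hs.disj.symm, by rw [Set.union_comm]; exact hs.cofin,
    fun a ha b hb => by rw [G.symm]; exact hs.sep b hb a ha, hs.infRight, hs.infLeft⟩

lemma CombGraph.exists_ball (_ : CombGraph w m d) {S : Set V} (hS : S.Finite) (x₀ : V) :
    ∃ R, 0 ≤ R ∧ ∀ x ∈ S, d x x₀ ≤ R := by
  obtain ⟨R, hR⟩ := (hS.image fun x => d x x₀).bddAbove
  exact ⟨max R 0, le_max_right _ _, fun x hx => (hR ⟨x, hx, rfl⟩).trans (le_max_left _ _)⟩

lemma CombGraph.finite_ball (G : CombGraph w m d) (x₀ : V) (R : ℝ) : {x | d x x₀ ≤ R}.Finite := by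
  simpa only [G.comm _ x₀] using G.balls x₀ R

/-- Outside a ball, a split carries an extremal function that is harmonic on the ball. -/
lemma IsSplit.exists_isExtremal (G : CombGraph w m d) (hs : IsSplit w m A B) {x₀ : V} {R : ℝ}
    (hR : 0 ≤ R) (hball : ∀ x ∈ (A ∪ B)ᶜ, d x x₀ ≤ R) :
    ∃ h, IsExtremal d (A \ {x | d x x₀ ≤ R}) (B \ {x | d x x₀ ≤ R}) {x | d x x₀ ≤ R} h ∧
      ∀ u, d u x₀ ≤ R → lap w m h u = 0 := by
  have hK := G.finite_ball x₀ R
  set K := {x | d x x₀ ≤ R} with hKdef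
  have hcov : A \ K ∪ B \ K ∪ K = Set.univ := by
    ext x
    simp only [Set.mem_union, Set.mem_sdiff, Set.mem_univ, iff_true]
    by_cases hxK : x ∈ K
    · exact Or.inr hxK
    · have : x ∈ A ∪ B := by
        by_contra hx
        exact hxK (hball x hx)
      rcases this with h | h
      · exact Or.inl (Or.inl ⟨h, hxK⟩)
      · exact Or.inl (Or.inr ⟨h, hxK⟩)
  have hsep : ∀ a ∈ A \ K, ∀ b ∈ B \ K, w a b = 0 := fun a ha b hb => hs.sep a ha.1 b hb.1
  have hnbr : ∀ x y, 0 < w x y → (x ∈ A \ K → y ∈ A \ K ∨ y ∈ K) ∧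
      (x ∈ B \ K → y ∈ B \ K ∨ y ∈ K) := by
    intro x y hw
    have hy : y ∈ A \ K ∪ B \ K ∪ K := hcov ▸ Set.mem_univ y
    refine ⟨fun hx => ?_, fun hx => ?_⟩
    · rcases hy with (hy | hy) | hy
      · exact Or.inl hy
      · exact absurd (hsep x hx y hy) hw.ne'
      · exact Or.inr hy
    · rcases hy with (hy | hy) | hy
      · exact absurd (hsep y hy x hx) (by rw [G.symm]; exact hw.ne')
      · exact Or.inl hy
      · exact Or.inr hy
  obtain ⟨f, c, hf, hfc⟩ := exists_isExtremal_lap_eq_const G hR hcov hsep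
    Set.disjoint_sdiff_left (hs.disj.mono Set.sdiff_subset Set.sdiff_subset)
  refine ⟨f, hf, ?_⟩
  rcases lt_trichotomy c 0 with hc | rfl | hc
  · exact (not_lap_le_neg G hK (fun x hx y hw => (hnbr x y hw).2 hx) (hs.infRight.diff G.pos hK)
      hf.1 (hf.finite_le G hK) hc (hf.lap_le G fun u hu => (hfc u hu).le)).elim
  · exact hfc
  · have hf' := hf.neg G
    refine (not_lap_le_neg G hK (fun x hx y hw => (hnbr x y hw).1 hx) (hs.infLeft.diff G.pos hK)
      hf'.1 (hf'.finite_le G hK) (neg_lt_zero.2 hc) (hf'.lap_le G fun u hu => ?_)).elim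
    rw [lap_neg, hfc u hu]

/-- Each side of a split has only one end. -/
lemma IsSplit.finite_of_union (G : CombGraph w m d) (x₀ : V) {Y₁ Y₂ : Set V}
    (hs : IsSplit w m X (Y₁ ∪ Y₂)) (hdisj : Disjoint Y₁ Y₂)
    (hsep : ∀ a ∈ Y₁, ∀ b ∈ Y₂, w a b = 0) (hinf : InfVolume m Y₁) : Y₂.Finite := by
  have hs' : IsSplit w m (X ∪ Y₂) Y₁ := by
    refine ⟨?_, ?_, ?_, hs.infLeft.mono Set.subset_union_left, hinf⟩
    · rw [Set.disjoint_union_left]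
      exact ⟨(Set.disjoint_union_right.1 hs.disj).1, hdisj.symm⟩
    · rw [Set.union_assoc, Set.union_comm Y₂]
      exact hs.cofin
    · rintro a (ha | ha) b hb
      · exact hs.sep a ha b (Or.inl hb)
      · rw [G.symm]
        exact hsep b hb a ha
  obtain ⟨R, hR, hball⟩ := G.exists_ball hs.cofin x₀
  obtain ⟨H, hH, hH0⟩ := hs.exists_isExtremal G hR hball
  obtain ⟨h, hh, hh0⟩ := hs'.exists_isExtremal G hR (x₀ := x₀) fun x hx => hball x (by
    rwa [Set.union_assoc, Set.union_comm Y₂] at hx)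
  have hK := G.finite_ball x₀ R
  set K := {x | d x x₀ ≤ R} with hKdef
  have hcase : ∀ x, x ∈ X \ K ∨ x ∈ Y₁ \ K ∨ x ∈ Y₂ \ K ∨ x ∈ K := by
    intro x
    by_cases hxK : x ∈ K
    · exact Or.inr (Or.inr (Or.inr hxK))
    · have : x ∈ X ∪ (Y₁ ∪ Y₂) := by
        by_contra hx
        exact hxK (hball x hx)
      rcases this with h | h | h
      · exact Or.inl ⟨h, hxK⟩
      · exact Or.inr (Or.inl ⟨h, hxK⟩)
      · exact Or.inr (Or.inr (Or.inl ⟨h, hxK⟩))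
  have hx₀ : x₀ ∈ K := by
    change d x₀ x₀ ≤ R
    rwa [G.self]
  obtain ⟨u₀, hu₀, hmin⟩ := Set.exists_min_image K (fun u => H u - h u) hK ⟨x₀, hx₀⟩
  have hglob : ∀ x, H u₀ - h u₀ ≤ H x - h x := by
    have hdown : ∀ x, (∃ u ∈ K, h x = h u - d x u) → H u₀ - h u₀ ≤ H x - h x := by
      rintro x ⟨u, hu, hxu⟩
      have h1 := hmin u hu
      have h2 := hH.1 x u
      linarith
    intro x
    rcases hcase x with hx | hx | hx | hx
    · exact hdown x (hh.2.1 x ⟨Or.inl hx.1, hx.2⟩)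
    · obtain ⟨u, hu, hxu⟩ := hH.2.2 x ⟨Or.inl hx.1, hx.2⟩
      have h1 := hmin u hu
      have h2 := hh.1 u x
      rw [G.comm u x] at h2
      linarith
    · exact hdown x (hh.2.1 x ⟨Or.inr hx.1, hx.2⟩)
    · exact hmin x hx
  have hprop : ∀ x, (x ∈ K ∨ x ∈ Y₂ \ K) → H x - h x = H u₀ - h u₀ →
      ∀ y, 0 < w x y → H y - h y = H u₀ - h u₀ := by
    intro x hx hxe y hw
    have hlap : 0 ≤ lap w m (fun z => h z - H z) x := by
      rw [lap_sub G.nonneg G.locFin]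
      rcases hx with hx | hx
      · rw [hh0 x hx, hH0 x hx, sub_zero]
      · have h1 := hh.le_lap G (fun u hu => (hh0 u hu).ge) x ⟨Or.inr hx.1, hx.2⟩
        have h2 := hH.lap_le G (fun u hu => (hH0 u hu).le) x ⟨Or.inr hx.1, hx.2⟩
        linarith
    have := eq_of_isLocalMax G.nonneg G.pos G.locFin hlap
      (fun z _ => by linarith [hglob z]) hw
    linarith
  have hKeq : ∀ x, d x x₀ ≤ R → H x - h x = H u₀ - h u₀ :=
    G.forall_ball_of_closed (P := fun x => H x - h x = H u₀ - h u₀)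
      (fun x y hx _ hw hxe => hprop x (Or.inl hx) hxe y hw) hu₀ rfl
  have hYeq : ∀ x, x ∈ Y₂ \ K → H x - h x = H u₀ - h u₀ := by
    refine G.induction_dist x₀ (P := fun x => x ∈ Y₂ \ K → H x - h x = H u₀ - h u₀)
      (fun hx => absurd hx₀ hx.2) ?_
    intro x z hw hz hind hx
    have hw' : 0 < w z x := by rwa [G.symm]
    rcases hcase z with hz | hz | hz | hz
    · exact absurd (hs.sep z hz.1 x (Or.inr hx.1)) hw'.ne'
    · exact absurd (hsep z hz.1 x hx.1) hw'.ne'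
    · exact hprop z (Or.inr hz) (hind hz) x hw'
    · exact hprop z (Or.inl hz) (hKeq z hz) x hw'
  obtain ⟨M, hM⟩ := (hK.image h).bddAbove
  refine (hK.union (hH.finite_le G hK (M + (H u₀ - h u₀)))).subset fun x hx => ?_
  by_cases hxK : x ∈ K
  · exact Or.inl hxK
  · refine Or.inr ⟨⟨Or.inr hx, hxK⟩, ?_⟩
    have h1 := hYeq x ⟨hx, hxK⟩
    obtain ⟨u, hu, hxu⟩ := hh.2.1 x ⟨Or.inr hx, hxK⟩
    have h2 := hM ⟨u, hu, rfl⟩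
    have h3 := G.dist_nonneg x u
    linarith

end Split

/-- `f` is a 1-Lipschitz harmonic function that increases and decreases with slope one from every
vertex. -/
structure IsSharp (w : V → V → ℝ) (m : V → ℝ) (d : V → V → ℝ) (f : V → ℝ) : Prop where
  lip : Lip1 d f
  harm : ∀ x, lap w m f x = 0
  up : ∀ x, ∃ y, 0 < w x y ∧ f y = f x + 1
  down : ∀ x, ∃ y, 0 < w x y ∧ f y = f x - 1

section Sharp

variable {w : V → V → ℝ} {m : V → ℝ} {d : V → V → ℝ} {X Y : Set V} {f g : V → ℝ}

lemma IsSharp.neg (G : CombGraph w m d) (hf : IsSharp w m d f) :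
    IsSharp w m d fun x => -f x := by
  refine ⟨G.lip_neg hf.lip, fun x => by rw [lap_neg, hf.harm, neg_zero], fun x => ?_, fun x => ?_⟩
  · obtain ⟨y, hw, hy⟩ := hf.down x
    exact ⟨y, hw, by linarith⟩
  · obtain ⟨y, hw, hy⟩ := hf.up x
    exact ⟨y, hw, by linarith⟩

lemma exists_eq_one_of_sSup_eq_one {ι : Type*} {S : Set ι} (hS : S.Finite) {φ : ι → ℝ}
    (h : sSup {c | ∃ y, y ∈ S ∧ c = φ y} = 1) : ∃ y ∈ S, φ y = 1 := by
  have heq : {c | ∃ y, y ∈ S ∧ c = φ y} = φ '' S := by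
    ext c
    simp [eq_comm]
  rw [heq] at h
  have hne : (φ '' S).Nonempty := by
    by_contra hcon
    rw [Set.not_nonempty_iff_eq_empty.1 hcon, Real.sSup_empty] at h
    exact zero_ne_one h
  obtain ⟨y, hy, hy1⟩ := hne.csSup_mem (hS.image φ)
  exact ⟨y, hy, hy1.trans h⟩

lemma isSharp_of_grad (G : CombGraph w m d) (hlip : Lip1 d f) (hharm : ∀ x, lap w m f x = 0)
    (hgrad : ∀ x, gradPlus w d f x = 1 ∧ gradMinus w d f x = 1) : IsSharp w m d f := by
  refine ⟨hlip, hharm, fun x => ?_, fun x => ?_⟩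
  · obtain ⟨y, hw, hy⟩ := exists_eq_one_of_sSup_eq_one (G.locFin x) (hgrad x).1
    rw [G.edge x y hw, div_one] at hy
    exact ⟨y, hw, by linarith⟩
  · obtain ⟨y, hw, hy⟩ := exists_eq_one_of_sSup_eq_one (G.locFin x) (hgrad x).2
    rw [G.edge x y hw, div_one] at hy
    exact ⟨y, hw, by linarith⟩

lemma apply_iterate {up : V → V} (hup : ∀ x, f (up x) = f x + 1) (x : V) (i : ℕ) :
    f (up^[i] x) = f x + i := by
  induction i with
  | zero => simp
  | succ i ih => rw [Function.iterate_succ_apply', hup, ih]; push_cast; ring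

lemma infinite_range_iterate {up : V → V} (hup : ∀ x, f (up x) = f x + 1) (x : V) :
    (Set.range fun i => up^[i] x).Infinite := by
  refine Set.infinite_range_of_injective fun i j hij => ?_
  have h1 := apply_iterate hup x i
  rw [show up^[i] x = up^[j] x from hij, apply_iterate hup x j] at h1
  exact_mod_cast (by linarith : (i : ℝ) = j)

lemma CombGraph.dist_iterate_le (G : CombGraph w m d) {up : V → V} (hw : ∀ x, 0 < w x (up x))
    (x : V) (i : ℕ) : d x (up^[i] x) ≤ i := by
  induction i with
  | zero => simp [G.self]
  | succ i ih =>
    rw [Function.iterate_succ_apply']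
    have h1 := G.tri x (up^[i] x) (up (up^[i] x))
    rw [G.edge _ _ (hw _)] at h1
    push_cast
    linarith

lemma IsSplit.diff_right (G : CombGraph w m d) (hs : IsSplit w m X Y) {E : Set V}
    (hE : E.Finite) : IsSplit w m X (Y \ E) := by
  refine ⟨hs.disj.mono_right Set.sdiff_subset, (hs.cofin.union hE).subset fun x hx => ?_,
    fun a ha b hb => hs.sep a ha b hb.1, hs.infLeft, hs.infRight.diff G.pos hE⟩
  by_cases hxE : x ∈ E
  · exact Or.inr hxE
  · refine Or.inl fun h => hx ?_
    rcases h with h | h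
    · exact Or.inl h
    · exact Or.inr ⟨h, hxE⟩

lemma IsSplit.mem_diff_or_mem (G : CombGraph w m d) (hs : IsSplit w m X Y) {K : Set V}
    (hK : (X ∪ Y)ᶜ ⊆ K) {x y : V} (hw : 0 < w x y) (hx : x ∈ Y \ K) : y ∈ Y \ K ∨ y ∈ K := by
  by_cases hyK : y ∈ K
  · exact Or.inr hyK
  · have hy : y ∈ X ∪ Y := by
      by_contra hy
      exact hyK (hK hy)
    rcases hy with hy | hy
    · exact absurd (hs.sep y hy x hx.1) (by rw [G.symm]; exact hw.ne')
    · exact Or.inl ⟨hy, hyK⟩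

/-- If a single gradient ray of a sharp harmonic function stays on one side of a split, then the
function tends to infinity on that side. -/
lemma IsSplit.finite_le_of_ray (G : CombGraph w m d) (hs : IsSplit w m X Y) {K : Set V} (x₀ : V)
    (hKfin : K.Finite) (hK : (X ∪ Y)ᶜ ⊆ K) {h : V → ℝ} (hh : IsExtremal d (X \ K) (Y \ K) K h)
    (hh0 : ∀ u ∈ K, lap w m h u = 0) (hf : IsSharp w m d f) {up : V → V}
    (hw : ∀ x, 0 < w x (up x)) (hup : ∀ x, f (up x) = f x + 1) {x : V}
    (hx : ∀ i, up^[i] x ∈ Y \ K) (t : ℝ) : {y ∈ Y | f y ≤ t}.Finite := by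
  have hnbr : ∀ {a b}, 0 < w a b → a ∈ Y \ K → b ∈ Y \ K ∨ b ∈ K :=
    fun hab ha => hs.mem_diff_or_mem G hK hab ha
  obtain ⟨Mf, hMf⟩ := (hKfin.image f).bddAbove
  obtain ⟨Mh, hMh⟩ := (hKfin.image h).bddAbove
  replace hMf : ∀ u ∈ K, f u ≤ Mf := fun u hu => hMf ⟨u, hu, rfl⟩
  replace hMh : ∀ u ∈ K, h u ≤ Mh := fun u hu => hMh ⟨u, hu, rfl⟩
  obtain ⟨n, hn1, hn2⟩ : ∃ n, Mf < f x - h x + n ∧ Mh < n :=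
    ⟨max (Mf - (f x - h x)) Mh + 1, by linarith [le_max_left (Mf - (f x - h x)) Mh],
      by linarith [le_max_right (Mf - (f x - h x)) Mh]⟩
  have hstep : ∀ {f'}, Lip1 d f' → ∀ {a b}, 0 < w a b → f' b ≤ f' a + 1 := by
    intro f' hf' a b hab
    have := hf' a b
    rw [G.edge a b hab] at this
    linarith
  have hmono : ∀ y i, f y - h y ≤ f (up^[i] y) - h (up^[i] y) := by
    intro y i
    induction i with
    | zero => simp
    | succ i ih =>
      rw [Function.iterate_succ_apply', hup]
      linarith [hstep hh.1 (hw (up^[i] y))]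
  have hstay : ∀ y ∈ Y \ K, n ≤ h y → f x - h x ≤ f y - h y → ∀ i, up^[i] y ∈ Y \ K := by
    intro y hy hny hvy i
    induction i with
    | zero => exact hy
    | succ i ih =>
      refine (hnbr (by rw [Function.iterate_succ_apply']; exact hw _) ih).resolve_right fun hmem => ?_
      have h1 := hMf _ hmem
      rw [apply_iterate hup] at h1
      have : (0 : ℝ) ≤ ((i + 1 : ℕ) : ℝ) := Nat.cast_nonneg _
      linarith
  have hfar : ∀ y, (∀ i, up^[i] y ∈ Y \ K) → ∀ s, {z | (∃ i, up^[i] y = z) ∧ s < h z}.Infinite := by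
    intro y hy s
    have h1 := (infinite_range_iterate hup y).sdiff (hh.finite_le G hKfin s)
    refine h1.mono ?_
    rintro _ ⟨⟨i, rfl⟩, hi⟩
    refine ⟨⟨i, rfl⟩, ?_⟩
    by_contra! hcon
    exact hi ⟨hy i, hcon⟩
  have hdown : ∀ k : ℕ, ∀ y ∈ Y \ K, n ≤ h y → h y < n + 1 + k →
      ∃ z ∈ Y \ K, n ≤ h z ∧ h z ≤ n + 1 ∧ f y - h y ≤ f z - h z := by
    intro k
    induction k with
    | zero =>
      intro y hy hny hlt
      exact ⟨y, hy, hny, by push_cast at hlt; linarith, le_rfl⟩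
    | succ k ih =>
      intro y hy hny hlt
      by_cases hle : h y ≤ n + 1
      · exact ⟨y, hy, hny, hle, le_rfl⟩
      obtain ⟨u, hu, hyu⟩ := hh.2.2 y hy
      have hne : y ≠ u := by
        rintro rfl
        exact hy.2 hu
      obtain ⟨z, hwz, hz⟩ := G.step y u hne
      have h1 := hh.1 u z
      have h2 := hstep hh.1 (show 0 < w z y by rwa [G.symm])
      have h3 := hstep hf.lip (show 0 < w z y by rwa [G.symm])
      rw [G.comm u z] at h1
      have hzY : z ∈ Y \ K := (hnbr hwz hy).resolve_right fun hzK => by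
        linarith [hMh z hzK]
      push_cast at hlt
      obtain ⟨z', hz', ha, hb, hc⟩ := ih z hzY (by linarith) (by linarith)
      exact ⟨z', hz', ha, hb, by linarith⟩
  have hfin : {y ∈ Y \ K | h y ≤ n + 1}.Finite := hh.finite_le G hKfin _
  have hdown' : ∀ y ∈ Y \ K, n ≤ h y →
      ∃ z ∈ {y ∈ {y ∈ Y \ K | h y ≤ n + 1} | n ≤ h y}, f y - h y ≤ f z - h z := by
    intro y hy hny
    obtain ⟨k, hk⟩ := exists_nat_gt (h y - (n + 1))
    obtain ⟨z, hz, ha, hb, hc⟩ := hdown k y hy hny (by linarith)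
    exact ⟨z, ⟨⟨hz, hb⟩, ha⟩, hc⟩
  obtain ⟨_, ⟨i₀, rfl⟩, hi₀⟩ := (hfar x hx n).nonempty
  obtain ⟨z₀, hz₀, hz₀'⟩ := hdown' _ (hx i₀) hi₀.le
  obtain ⟨z, ⟨⟨hzY, -⟩, hzn⟩, hzmax⟩ := Set.exists_max_image _ (fun y => f y - h y)
    (hfin.subset (Set.sep_subset _ fun y => n ≤ h y)) ⟨z₀, hz₀⟩
  set N := f z - h z with hN
  have hle : ∀ y ∈ Y \ K, n ≤ h y → f y - h y ≤ N := by
    intro y hy hny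
    obtain ⟨z', hz', hle⟩ := hdown' y hy hny
    exact hle.trans (hzmax z' hz')
  have hzx : f x - h x ≤ N := (hmono x i₀).trans (hz₀'.trans (hzmax z₀ hz₀))
  have hzray := hstay z hzY hzn hzx
  set E := K ∪ {y ∈ Y \ K | h y ≤ n + 1} with hEdef
  have hE : E.Finite := hKfin.union hfin
  have hYE : ∀ y, y ∈ Y \ E → y ∈ Y \ K ∧ n + 1 < h y := by
    rintro y ⟨hy, hyE⟩
    have hyK : y ∉ K := fun h => hyE (Or.inl h)
    refine ⟨⟨hy, hyK⟩, ?_⟩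
    by_contra! hcon
    exact hyE (Or.inr ⟨⟨hy, hyK⟩, hcon⟩)
  set Z := {y ∈ Y \ E | f y - h y = N} with hZ
  set W := {y ∈ Y \ E | f y - h y ≠ N} with hW
  have hZW : Y \ E = Z ∪ W := by
    ext y
    simp only [hZ, hW, Set.mem_union, Set.mem_sep_iff]
    tauto
  have hZinf : Z.Infinite := by
    refine (hfar z hzray (n + 1)).mono ?_
    rintro _ ⟨⟨i, rfl⟩, hi⟩
    refine ⟨⟨(hzray i).1, ?_⟩, le_antisymm (hle _ (hzray i) (by linarith)) (hmono z i)⟩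
    rintro (hmem | hmem)
    · exact (hzray i).2 hmem
    · exact hi.not_ge hmem.2
  have hdisj : Disjoint Z W := Set.disjoint_left.2 fun y hy hy' => hy'.2 hy.2
  have hsep : ∀ a ∈ Z, ∀ b ∈ W, w a b = 0 := by
    intro a ha b hb
    by_contra hne
    have hab : 0 < w a b := lt_of_le_of_ne (G.nonneg a b) (Ne.symm hne)
    obtain ⟨haY, hah⟩ := hYE a ha.1
    refine hb.2 ?_
    rw [← ha.2]
    refine eq_of_isLocalMax (u := fun y => f y - h y) G.nonneg G.pos G.locFin ?_ ?_ hab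
    · rw [lap_sub G.nonneg G.locFin, hf.harm]
      linarith [hh.lap_le G (fun u hu => (hh0 u hu).le) a haY]
    · intro y hay
      have h1 := hstep hh.1 (show 0 < w y a by rwa [G.symm])
      have hyY : y ∈ Y \ K := (hnbr hay haY).resolve_right fun hyK => by
        linarith [hMh y hyK]
      exact (hle y hyY (by linarith)).trans ha.2.ge
  have hs' : IsSplit w m X (Z ∪ W) := hZW ▸ hs.diff_right G hE
  have hWfin : W.Finite := by
    rcases hs'.infRight.of_union with hinf | hinf
    · exact hs'.finite_of_union G x₀ hdisj hsep hinf
    · refine absurd (IsSplit.finite_of_union G x₀ (Set.union_comm Z W ▸ hs') hdisj.symm ?_ hinf) hZinf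
      intro a ha b hb
      rw [G.symm]
      exact hsep b hb a ha
  refine ((hE.union hWfin).union (hh.finite_le G hKfin (t - N))).subset ?_
  rintro y ⟨hy, hyt⟩
  by_cases hyE : y ∈ E
  · exact Or.inl (Or.inl hyE)
  by_cases hyN : f y - h y = N
  · exact Or.inr ⟨(hYE y ⟨hy, hyE⟩).1, by linarith⟩
  · exact Or.inl (Or.inr ⟨⟨hy, hyE⟩, hyN⟩)

/-- On each side of a split, a sharp harmonic function tends to `+∞` or to `-∞`. -/
lemma IsSplit.finite_le_or_finite_ge (G : CombGraph w m d) (hs : IsSplit w m X Y) (x₀ : V)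
    (hf : IsSharp w m d f) :
    (∀ t, {y ∈ Y | f y ≤ t}.Finite) ∨ ∀ t, {y ∈ Y | t ≤ f y}.Finite := by
  obtain ⟨R, hR, hball⟩ := G.exists_ball hs.cofin x₀
  obtain ⟨h, hh, hh0⟩ := hs.exists_isExtremal G hR hball
  have hK := G.finite_ball x₀ R
  set K := {x | d x x₀ ≤ R} with hKdef
  obtain ⟨x, hxY, hxR⟩ : ∃ x ∈ Y, 2 * R < d x x₀ := by
    by_contra! hcon
    exact hs.infRight.not_finite G.pos ((G.finite_ball x₀ (2 * R)).subset hcon)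
  have hxK : x ∉ K := fun h => by
    have : d x x₀ ≤ R := h
    linarith
  choose up hupw hup using hf.up
  choose dn hdnw hdn using (hf.neg G).up
  have hray : ∀ p : V → V, (∀ x, 0 < w x (p x)) → (∀ i, p^[i] x ∉ K) → ∀ i, p^[i] x ∈ Y \ K := by
    intro p hp hpK i
    induction i with
    | zero => exact ⟨hxY, hxK⟩
    | succ i ih =>
      refine (hs.mem_diff_or_mem G hball ?_ ih).resolve_right (hpK _)
      rw [Function.iterate_succ_apply']
      exact hp _
  by_cases h1 : ∀ i, up^[i] x ∉ K
  · exact Or.inl (hs.finite_le_of_ray G x₀ hK hball hh hh0 hf hupw hup (hray up hupw h1))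
  by_cases h2 : ∀ i, dn^[i] x ∉ K
  · refine Or.inr fun t => ?_
    have := hs.finite_le_of_ray G x₀ hK hball hh hh0 (hf.neg G) hdnw hdn (hray dn hdnw h2) (-t)
    simpa using this
  push Not at h1 h2
  obtain ⟨i, hi⟩ := h1
  obtain ⟨j, hj⟩ := h2
  have hi' : d (up^[i] x) x₀ ≤ R := hi
  have hj' : d (dn^[j] x) x₀ ≤ R := hj
  have e1 := apply_iterate hup x i
  have e2 := apply_iterate (f := fun x => -f x) hdn x j
  have e3 := hf.lip (dn^[j] x) (up^[i] x)
  have e4 := G.tri (dn^[j] x) x₀ (up^[i] x)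
  rw [G.comm x₀] at e4
  have e5 := G.tri x (up^[i] x) x₀
  have e6 := G.tri x (dn^[j] x) x₀
  have e7 := G.dist_iterate_le hupw x i
  have e8 := G.dist_iterate_le hdnw x j
  linarith

/-- `f` tends to `-∞` on `X` and to `+∞` on `Y`. -/
def Separates (X Y : Set V) (f : V → ℝ) : Prop :=
  (∀ t, {x ∈ X | t ≤ f x}.Finite) ∧ ∀ t, {y ∈ Y | f y ≤ t}.Finite

lemma IsSharp.not_finite_le (hf : IsSharp w m d f) (x : V) : ¬{y | f y ≤ f x}.Finite := by
  intro hfin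
  obtain ⟨y, hy, hmin⟩ := Set.exists_min_image _ f hfin ⟨x, le_refl (f x)⟩
  obtain ⟨z, -, hz⟩ := hf.down y
  have hy' : f y ≤ f x := hy
  have := hmin z (by change f z ≤ f x; linarith)
  linarith

/-- A sharp harmonic function or its negative separates the two sides of a split. -/
lemma IsSplit.separates_or (G : CombGraph w m d) (hs : IsSplit w m X Y) (x₀ : V)
    (hf : IsSharp w m d f) : Separates X Y f ∨ Separates X Y fun x => -f x := by
  have hnot : ∀ {f}, IsSharp w m d f → (∀ t, {x ∈ X | f x ≤ t}.Finite) →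
      ¬∀ t, {y ∈ Y | f y ≤ t}.Finite := by
    intro f hf hX hY
    refine hf.not_finite_le x₀ (((hX (f x₀)).union (hY (f x₀))).union hs.cofin |>.subset ?_)
    intro x hx
    by_cases hmem : x ∈ X ∪ Y
    · rcases hmem with h | h
      · exact Or.inl (Or.inl ⟨h, hx⟩)
      · exact Or.inl (Or.inr ⟨h, hx⟩)
    · exact Or.inr hmem
  have hneg : ∀ {S : Set V}, (∀ t, {x ∈ S | t ≤ f x}.Finite) →
      ∀ t, {x ∈ S | -f x ≤ t}.Finite := fun hS t => by
    simpa only [neg_le] using hS (-t)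
  have hneg' : ∀ {S : Set V}, (∀ t, {x ∈ S | f x ≤ t}.Finite) →
      ∀ t, {x ∈ S | t ≤ -f x}.Finite := fun hS t => by
    simpa only [le_neg] using hS (-t)
  rcases (hs.symm G).finite_le_or_finite_ge G x₀ hf with hX | hX <;>
    rcases hs.finite_le_or_finite_ge G x₀ hf with hY | hY
  · exact absurd hY (hnot hf hX)
  · exact Or.inr ⟨hneg' hX, hneg hY⟩
  · exact Or.inl ⟨hX, hY⟩
  · exact absurd (hneg hY) (hnot (hf.neg G) (hneg hX))

lemma IsSharp.exists_ge (G : CombGraph w m d) (hf : IsSharp w m d f) (hg : Lip1 d g) (x : V)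
    (hx : f x < 0) : ∃ z, 0 ≤ f z ∧ f z < 1 ∧ f x - g x ≤ f z - g z := by
  obtain ⟨k, hk⟩ := exists_nat_ge (-f x)
  induction k generalizing x with
  | zero =>
    push_cast at hk
    linarith
  | succ k ih =>
    obtain ⟨y, hw, hy⟩ := hf.up x
    have h1 := hg x y
    rw [G.edge x y hw] at h1
    push_cast at hk
    by_cases h0 : f y < 0
    · obtain ⟨z, ha, hb, hc⟩ := ih y h0 (by linarith)
      exact ⟨z, ha, hb, by linarith⟩
    · exact ⟨y, by linarith, by linarith, by linarith⟩

/-- Sharp harmonic functions that separate the two sides in the same way differ by a constant. -/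
lemma IsSharp.exists_sub_eq_const (G : CombGraph w m d) (hcof : (X ∪ Y)ᶜ.Finite) (x₀ : V)
    (hf : IsSharp w m d f) (hg : IsSharp w m d g) (hfs : Separates X Y f)
    (hgs : Separates X Y g) : ∃ c : ℝ, ∀ x, f x - g x = c := by
  set T := {x | (0 ≤ f x ∧ f x ≤ 1) ∨ (0 ≤ g x ∧ g x ≤ 1) ∨ (0 ≤ f x ∧ g x ≤ 1)} with hTdef
  have hT : T.Finite := by
    refine ((((hfs.1 0).union (hgs.1 0)).union ((hfs.2 1).union (hgs.2 1))).union hcof).subset ?_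
    intro x hx
    by_cases hmem : x ∈ X ∪ Y
    · refine Or.inl ?_
      rcases hmem with h | h
      · refine Or.inl ?_
        rcases hx with hx | hx | hx
        · exact Or.inl ⟨h, hx.1⟩
        · exact Or.inr ⟨h, hx.1⟩
        · exact Or.inl ⟨h, hx.1⟩
      · refine Or.inr ?_
        rcases hx with hx | hx | hx
        · exact Or.inl ⟨h, hx.2⟩
        · exact Or.inr ⟨h, hx.2⟩
        · exact Or.inr ⟨h, hx.2⟩
    · exact Or.inr hmem
  have hdom : ∀ x, ∃ z ∈ T, f x - g x ≤ f z - g z := by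
    intro x
    by_cases hfx : f x < 0
    · obtain ⟨z, ha, hb, hc⟩ := hf.exists_ge G hg.lip x hfx
      exact ⟨z, Or.inl ⟨ha, hb.le⟩, hc⟩
    by_cases hgx : g x ≤ 1
    · exact ⟨x, Or.inr (Or.inr ⟨not_lt.1 hfx, hgx⟩), le_rfl⟩
    · have hgn : IsSharp w m d fun x => 1 - g x := ⟨G.lip_of_edge fun a b hab => by
          have := hg.lip b a
          rw [G.comm, G.edge a b hab] at this
          linarith, fun x => by
          simpa [sub_eq_neg_add, lap_neg, hg.harm] using lap_add_const (w := w) (m := m) (fun y => -g y) 1 x,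
        fun a => (hg.down a).imp fun b hb => ⟨hb.1, by linarith [hb.2]⟩,
        fun a => (hg.up a).imp fun b hb => ⟨hb.1, by linarith [hb.2]⟩⟩
      obtain ⟨z, ha, hb, hc⟩ := hgn.exists_ge G (G.lip_neg hf.lip) x (by linarith)
      exact ⟨z, Or.inr (Or.inl ⟨by linarith, by linarith⟩), by linarith⟩
  obtain ⟨z₀, hz₀, -⟩ := hdom x₀
  obtain ⟨z, -, hz⟩ := Set.exists_max_image T (fun x => f x - g x) hT ⟨z₀, hz₀⟩
  have hmax : ∀ x, f x - g x ≤ f z - g z := fun x =>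
    let ⟨z', hz', hle⟩ := hdom x
    hle.trans (hz z' hz')
  refine ⟨f z - g z, fun x => G.forall_of_closed (P := fun x => f x - g x = f z - g z) ?_ rfl x⟩
  intro x y hw hx
  rw [← hx]
  refine eq_of_isLocalMax (u := fun y => f y - g y) G.nonneg G.pos G.locFin ?_ ?_ hw
  · rw [lap_sub G.nonneg G.locFin, hf.harm, hg.harm, sub_zero]
  · exact fun y _ => (hmax y).trans hx.ge

end Sharp

/-- **Theorem (Uniqueness of Lipschitz-sharp harmonic functions).** On a salami
with combinatorial distance, if `f, g ∈ ℋ₀` (harmonic, 1-Lipschitz, with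
`∇₊ = ∇₋ = 1` everywhere), then `f - g` or `f + g` is constant. -/
theorem lipschitz_sharp_harmonic_unique {V : Type*} (w : V → V → ℝ) (m : V → ℝ)
    (hS : IsSalami w m (combDist w))
    (f g : V → ℝ)
    (hfLip : Lip1 (combDist w) f) (hfharm : ∀ x, lap w m f x = 0)
    (hfgrad : ∀ x, gradPlus w (combDist w) f x = 1 ∧
      gradMinus w (combDist w) f x = 1)
    (hgLip : Lip1 (combDist w) g) (hgharm : ∀ x, lap w m g x = 0)
    (hggrad : ∀ x, gradPlus w (combDist w) g x = 1 ∧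
      gradMinus w (combDist w) g x = 1) :
    (∃ c : ℝ, ∀ x, f x - g x = c) ∨ (∃ c : ℝ, ∀ x, f x + g x = c) := by
  have G := combGraph_of_isSalami hS
  obtain ⟨-, -, X, Y, K, hcov, hXY, -, -, hK, hsep, hX, hY⟩ := hS
  have hs : IsSplit w m X Y := by
    refine ⟨hXY, hK.subset fun x hx => ?_, hsep, hX, hY⟩
    have : x ∈ X ∪ Y ∪ K := hcov ▸ Set.mem_univ x
    exact this.resolve_left hx
  obtain ⟨x₀, -⟩ : X.Nonempty := by
    by_contra hcon
    rw [Set.not_nonempty_iff_eq_empty.1 hcon] at hX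
    exact hX.not_finite G.pos Set.finite_empty
  have hf := isSharp_of_grad G hfLip hfharm hfgrad
  have hg := isSharp_of_grad G hgLip hgharm hggrad
  rcases hs.separates_or G x₀ hf with hfs | hfs <;>
    rcases hs.separates_or G x₀ hg with hgs | hgs
  · exact Or.inl (hf.exists_sub_eq_const G hs.cofin x₀ hg hfs hgs)
  · obtain ⟨c, hc⟩ := hf.exists_sub_eq_const G hs.cofin x₀ (hg.neg G) hfs hgs
    exact Or.inr ⟨c, fun x => by linarith [hc x]⟩
  · obtain ⟨c, hc⟩ := (hf.neg G).exists_sub_eq_const G hs.cofin x₀ hg hfs hgs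
    exact Or.inr ⟨-c, fun x => by linarith [hc x]⟩
  · obtain ⟨c, hc⟩ := (hf.neg G).exists_sub_eq_const G hs.cofin x₀ (hg.neg G) hfs hgs
    exact Or.inl ⟨-c, fun x => by linarith [hc x]⟩

end SalamiPaper
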